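/- Let p(·) ∈ 𝒫(ℝⁿ) with p₊ = ess sup_{ℝⁿ} p < ∞. Then there exists a constant C > 0 such that ∫_{ℝⁿ} (Mf(x))^{p(x)} dx ≤ C ∫_{ℝⁿ} |f(x)|^{p(x)} dx for every measurable function f if and only if there exists a constant p > 1 such that p(x) = p for almost every x ∈ ℝⁿ. -/

import Mathlib

open MeasureTheory Set ENNReal

noncomputable section

/-- The open axis-parallel cube with lower corner `a` and side length `s`. -/
def cube {n : ℕ} (a : Fin n → ℝ) (s : ℝ) : Set (Fin n → ℝ) :=
  Set.univ.pi fun i => Set.Ioo (a i) (a i + s)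

/-- The uncentered Hardy–Littlewood maximal function: the supremum, over all open
axis-parallel cubes `Q` containing `x`, of the average of `|f|` over `Q`. -/
def mx {n : ℕ} (f : (Fin n → ℝ) → ℝ) (x : Fin n → ℝ) : ℝ≥0∞ :=
  ⨆ (a : Fin n → ℝ) (s : ℝ) (_ : 0 < s) (_ : x ∈ cube a s),
    (volume (cube a s))⁻¹ * ∫⁻ y in cube a s, (‖f y‖₊ : ℝ≥0∞)

/-- Maximal function of a function defined on `Ω`, computed after extending by zero. -/
def mxOn {n : ℕ} (Ω : Set (Fin n → ℝ)) (f : (Fin n → ℝ) → ℝ) (x : Fin n → ℝ) : ℝ≥0∞ :=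
  mx (Ω.indicator f) x

/-- `p₊(E)`: the essential supremum of the exponent over `E`. -/
def pSup {n : ℕ} (E : Set (Fin n → ℝ)) (p : (Fin n → ℝ) → ℝ) : ℝ≥0∞ :=
  essSup (fun x => ENNReal.ofReal (p x)) (volume.restrict E)

/-- `p₋(E)`: the essential infimum of the exponent over `E`. -/
def pInf {n : ℕ} (E : Set (Fin n → ℝ)) (p : (Fin n → ℝ) → ℝ) : ℝ≥0∞ :=
  essInf (fun x => ENNReal.ofReal (p x)) (volume.restrict E)

/-- `p ∈ 𝒫(Ω)`: a measurable exponent function with values in `[1, ∞)` on `Ω`. -/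
def IsExponent {n : ℕ} (Ω : Set (Fin n → ℝ)) (p : (Fin n → ℝ) → ℝ) : Prop :=
  Measurable p ∧ ∀ x ∈ Ω, 1 ≤ p x

/-- The modular inequality `∫_Ω (Mf(x))^{p(x)} dx ≤ c₁ ∫_Ω |f(x)|^{q(x)} dx + c₂`
for every measurable function `f` on `Ω`. -/
def ModIneq {n : ℕ} (Ω : Set (Fin n → ℝ)) (p q : (Fin n → ℝ) → ℝ) (c₁ c₂ : ℝ) : Prop :=
  ∀ f : (Fin n → ℝ) → ℝ, Measurable f →
    ∫⁻ x in Ω, (mxOn Ω f x) ^ (p x) ≤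
      ENNReal.ofReal c₁ * ∫⁻ x in Ω, (‖f x‖₊ : ℝ≥0∞) ^ (q x) + ENNReal.ofReal c₂

/-- `p` and `q` touch at infinity on `Ω`: for every measurable `E ⊆ Ω` of infinite
measure, `p₊(E) = p₊(Ω) = q₋(Ω) = q₋(E)`. -/
def TouchAtInfinity {n : ℕ} (Ω : Set (Fin n → ℝ)) (p q : (Fin n → ℝ) → ℝ) : Prop :=
  ∀ E : Set (Fin n → ℝ), MeasurableSet E → E ⊆ Ω → volume E = ⊤ →
    pSup E p = pSup Ω p ∧ pSup Ω p = pInf Ω q ∧ pInf Ω q = pInf E q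

section Maximal

variable {n : ℕ}

lemma cube_eq_ball (a : Fin n → ℝ) {s : ℝ} (hs : 0 < s) :
    cube a s = Metric.ball (fun i => a i + s / 2) (s / 2) := by
  rw [ball_pi _ (by positivity), cube]
  congr 1
  funext i
  rw [Real.ball_eq_Ioo]
  congr 1 <;> ring

lemma isOpen_cube (a : Fin n → ℝ) (s : ℝ) : IsOpen (cube a s) :=
  isOpen_set_pi finite_univ fun _ _ => isOpen_Ioo

lemma volume_cube (a : Fin n → ℝ) (s : ℝ) : volume (cube a s) = ENNReal.ofReal s ^ n := by
  simp [cube, Real.volume_pi_Ioo]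

lemma volume_cube_ne_zero (a : Fin n → ℝ) {s : ℝ} (hs : 0 < s) : volume (cube a s) ≠ 0 := by
  rw [volume_cube]
  exact pow_ne_zero _ (by simpa using hs)

lemma volume_cube_ne_top (a : Fin n → ℝ) (s : ℝ) : volume (cube a s) ≠ ⊤ := by
  rw [volume_cube]
  exact ENNReal.pow_ne_top ENNReal.ofReal_ne_top

lemma average_le_mx (f : (Fin n → ℝ) → ℝ) {a x : Fin n → ℝ} {s : ℝ} (hs : 0 < s)
    (hx : x ∈ cube a s) :
    (volume (cube a s))⁻¹ * ∫⁻ y in cube a s, (‖f y‖₊ : ℝ≥0∞) ≤ mx f x :=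
  le_iSup₂_of_le a s <| le_iSup₂_of_le hs hx le_rfl

lemma lt_mx_iff {f : (Fin n → ℝ) → ℝ} {x : Fin n → ℝ} {t : ℝ≥0∞} :
    t < mx f x ↔ ∃ (a : Fin n → ℝ) (s : ℝ), 0 < s ∧ x ∈ cube a s ∧
      t < (volume (cube a s))⁻¹ * ∫⁻ y in cube a s, (‖f y‖₊ : ℝ≥0∞) := by
  simp only [mx, lt_iSup_iff, exists_prop]

lemma measurable_mx (f : (Fin n → ℝ) → ℝ) : Measurable (mx f) := by
  refine measurable_of_Ioi fun t => IsOpen.measurableSet ?_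
  rw [isOpen_iff_forall_mem_open]
  intro x hx
  obtain ⟨a, s, hs, hxs, h⟩ := lt_mx_iff.1 hx
  exact ⟨cube a s, fun y hy => lt_mx_iff.2 ⟨a, s, hs, hy, h⟩, isOpen_cube a s, hxs⟩

/-- The weak type `(1, 1)` inequality for the maximal function. -/
lemma volume_lt_mx_le (hn : 0 < n) (f : (Fin n → ℝ) → ℝ) {t : ℝ≥0∞} (ht : t ≠ 0) (ht' : t ≠ ⊤) :
    volume {x | t < mx f x} ≤ 5 ^ n * t⁻¹ * ∫⁻ x, (‖f x‖₊ : ℝ≥0∞) := by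
  set I := ∫⁻ x, (‖f x‖₊ : ℝ≥0∞)
  by_cases hItop : I = ⊤
  · rw [hItop, ENNReal.mul_top]
    · exact le_top
    · exact mul_ne_zero (pow_ne_zero _ (by norm_num)) (ENNReal.inv_ne_zero.2 ht')
  set T : Set ((Fin n → ℝ) × ℝ) :=
    {b | 0 < b.2 ∧ volume (cube b.1 b.2) ≤ t⁻¹ * ∫⁻ y in cube b.1 b.2, (‖f y‖₊ : ℝ≥0∞)}
  have hK : t⁻¹ * I ≠ ⊤ := ENNReal.mul_ne_top (ENNReal.inv_ne_top.2 ht) hItop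
  have hbound : ∀ b ∈ T, b.2 / 2 ≤ max 1 (t⁻¹ * I).toReal := by
    rintro ⟨a, s⟩ ⟨hs, h⟩
    simp only at hs h ⊢
    rcases le_total s 1 with h1 | h1
    · exact le_max_of_le_left (by linarith)
    · refine le_max_of_le_right ?_
      have h2 : ENNReal.ofReal (s ^ n) ≤ t⁻¹ * I := by
        rw [ENNReal.ofReal_pow hs.le, ← volume_cube a]
        exact h.trans (by gcongr; exact setLIntegral_le_lintegral _ _)
      have h3 := (ENNReal.ofReal_le_iff_le_toReal hK).1 h2
      have h4 : s ≤ s ^ n := le_self_pow₀ h1 hn.ne'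
      linarith
  obtain ⟨u, huT, hdisj, hcov⟩ := Vitali.exists_disjoint_subfamily_covering_enlargement_ball T
    (fun b i => b.1 i + b.2 / 2) (fun b => b.2 / 2) _ hbound 5 (by norm_num)
  have hball : ∀ b ∈ u, cube b.1 b.2 = Metric.ball (fun i => b.1 i + b.2 / 2) (b.2 / 2) :=
    fun b hb => cube_eq_ball _ (huT hb).1
  have hdisj' : u.PairwiseDisjoint fun b => cube b.1 b.2 := by
    intro b hb c hc hbc
    simpa only [Function.onFun, hball b hb, hball c hc] using hdisj hb hc hbc
  have hcount : u.Countable := hdisj'.countable_of_isOpen (fun b _ => isOpen_cube _ _) fun b hb =>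
    nonempty_of_measure_ne_zero (volume_cube_ne_zero b.1 (huT hb).1)
  calc volume {x | t < mx f x}
      ≤ volume (⋃ b ∈ u, Metric.ball (fun i => b.1 i + b.2 / 2) (5 * (b.2 / 2))) := by
        refine measure_mono fun x hx => ?_
        obtain ⟨a, s, hs, hxs, h⟩ := lt_mx_iff.1 hx
        have hmem : (a, s) ∈ T := by
          refine ⟨hs, ?_⟩
          have h1 := h.le
          rw [mul_comm, ← div_eq_mul_inv, ENNReal.le_div_iff_mul_le
            (Or.inl (volume_cube_ne_zero a hs)) (Or.inl (volume_cube_ne_top a s))] at h1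
          rwa [mul_comm t⁻¹, ← div_eq_mul_inv, ENNReal.le_div_iff_mul_le (Or.inl ht) (Or.inl ht'),
            mul_comm]
        obtain ⟨b, hb, hsub⟩ := hcov _ hmem
        rw [cube_eq_ball a hs] at hxs
        exact mem_biUnion hb (hsub hxs)
    _ ≤ ∑' b : u, volume (Metric.ball (fun i => b.1.1 i + b.1.2 / 2) (5 * (b.1.2 / 2))) :=
        measure_biUnion_le _ hcount _
    _ ≤ ∑' b : u, 5 ^ n * t⁻¹ * ∫⁻ y in cube b.1.1 b.1.2, (‖f y‖₊ : ℝ≥0∞) := by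
        refine ENNReal.tsum_le_tsum fun b => ?_
        have hs := (huT b.2).1
        rw [Real.volume_pi_ball _ (by positivity), Fintype.card_fin,
          show 2 * (5 * (b.1.2 / 2)) = 5 * b.1.2 by ring, mul_pow,
          ENNReal.ofReal_mul (by positivity), ENNReal.ofReal_pow hs.le, ← volume_cube b.1.1,
          ENNReal.ofReal_pow (by norm_num), mul_assoc]
        gcongr
        · norm_num
        · exact (huT b.2).2
    _ = 5 ^ n * t⁻¹ * ∫⁻ y in ⋃ b ∈ u, cube b.1 b.2, (‖f y‖₊ : ℝ≥0∞) := by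
        rw [ENNReal.tsum_mul_left, lintegral_biUnion hcount
          (fun b _ => (isOpen_cube _ _).measurableSet) hdisj']
    _ ≤ 5 ^ n * t⁻¹ * I := by
        gcongr
        exact setLIntegral_le_lintegral _ _

/-- The weak type inequality in which only the large values of the function contribute. -/
lemma volume_lt_mx_le_setLIntegral (hn : 0 < n) {f : (Fin n → ℝ) → ℝ} (hf : Measurable f) {t : ℝ}
    (ht : 0 < t) :
    volume {x | ENNReal.ofReal t < mx f x} ≤
      5 ^ n * 2 * (ENNReal.ofReal t)⁻¹ * ∫⁻ x in {x | t < 2 * ‖f x‖}, (‖f x‖₊ : ℝ≥0∞) := by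
  set S := {x | t < 2 * ‖f x‖} with hS
  have hSm : MeasurableSet S := measurableSet_lt measurable_const (hf.norm.const_mul 2)
  have key : ∀ y, (‖f y‖₊ : ℝ≥0∞) ≤ (‖S.indicator f y‖₊ : ℝ≥0∞) + ENNReal.ofReal (t / 2) := by
    intro y
    by_cases hy : y ∈ S
    · simp [hy]
    · simp only [hy, not_false_eq_true, indicator_of_notMem, nnnorm_zero, ENNReal.coe_zero,
        zero_add]
      rw [← enorm_eq_nnnorm, ← ofReal_norm]
      exact ENNReal.ofReal_le_ofReal (by simp only [hS, mem_ofPred_eq, not_lt] at hy; linarith)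
  have hsub : {x | ENNReal.ofReal t < mx f x} ⊆
      {x | ENNReal.ofReal (t / 2) < mx (S.indicator f) x} := by
    intro x hx
    obtain ⟨a, s, hs, hxs, h⟩ := lt_mx_iff.1 hx
    refine lt_mx_iff.2 ⟨a, s, hs, hxs, ?_⟩
    have h1 : (volume (cube a s))⁻¹ * ∫⁻ y in cube a s, (‖f y‖₊ : ℝ≥0∞) ≤
        (volume (cube a s))⁻¹ * (∫⁻ y in cube a s, (‖S.indicator f y‖₊ : ℝ≥0∞)) +
          ENNReal.ofReal (t / 2) := by
      calc _ ≤ (volume (cube a s))⁻¹ * ∫⁻ y in cube a s,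
            ((‖S.indicator f y‖₊ : ℝ≥0∞) + ENNReal.ofReal (t / 2)) := by
            gcongr with y
            exact key y
        _ = _ := by
            rw [lintegral_add_right _ measurable_const, setLIntegral_const, mul_add,
              mul_comm (ENNReal.ofReal (t / 2)), ← mul_assoc (volume (cube a s))⁻¹,
              ENNReal.inv_mul_cancel (volume_cube_ne_zero a hs) (volume_cube_ne_top a s), one_mul]
    have h2 := h.trans_le h1
    rw [show ENNReal.ofReal t = ENNReal.ofReal (t / 2) + ENNReal.ofReal (t / 2) by
      rw [← ENNReal.ofReal_add (by positivity) (by positivity), add_halves]] at h2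
    exact (ENNReal.add_lt_add_iff_right ENNReal.ofReal_ne_top).1 h2
  calc _ ≤ volume {x | ENNReal.ofReal (t / 2) < mx (S.indicator f) x} := measure_mono hsub
    _ ≤ 5 ^ n * (ENNReal.ofReal (t / 2))⁻¹ * ∫⁻ x, (‖S.indicator f x‖₊ : ℝ≥0∞) :=
        volume_lt_mx_le hn _ (by simpa using ht) ENNReal.ofReal_ne_top
    _ = _ := by
        rw [ENNReal.ofReal_div_of_pos (by norm_num), ENNReal.inv_div (by simp) (by simp),
          ← lintegral_indicator hSm, div_eq_mul_inv, ← mul_assoc]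
        simp only [nnnorm_indicator_eq_indicator_nnnorm, ENNReal.coe_indicator]
        norm_num

lemma iSup_min_natCast_rpow (y : ℝ≥0∞) {c : ℝ} (hc : 0 < c) :
    ⨆ N : ℕ, (min y N) ^ c = y ^ c := by
  have h := (ENNReal.orderIsoRpow c hc).map_iSup fun N : ℕ => min y N
  simp only [ENNReal.orderIsoRpow_apply] at h
  rw [← h, ← inf_iSup_eq, ENNReal.iSup_natCast, inf_top_eq]

/-- The Hardy–Littlewood maximal theorem. -/
lemma lintegral_mx_rpow_le (hn : 0 < n) {c : ℝ} (hc : 1 < c) {f : (Fin n → ℝ) → ℝ}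
    (hf : Measurable f) :
    ∫⁻ x, (mx f x) ^ c ≤ ENNReal.ofReal c * (5 ^ n * 2 * ((ENNReal.ofReal (c - 1))⁻¹ *
      ENNReal.ofReal (2 ^ (c - 1)))) * ∫⁻ x, (‖f x‖₊ : ℝ≥0∞) ^ c := by
  have hc0 : 0 < c := by linarith
  have hc1 : 0 < c - 1 := by linarith
  set ν := (volume : Measure (Fin n → ℝ)).withDensity fun x => (‖f x‖₊ : ℝ≥0∞) with hν
  set J := ∫⁻ t in Ioi (0 : ℝ), ν {x | t < 2 * ‖f x‖} * ENNReal.ofReal (t ^ (c - 1 - 1)) with hJ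
  have hJeq : J = (ENNReal.ofReal (c - 1))⁻¹ *
      (ENNReal.ofReal (2 ^ (c - 1)) * ∫⁻ x, (‖f x‖₊ : ℝ≥0∞) ^ c) := by
    have h1 := lintegral_rpow_eq_lintegral_meas_lt_mul ν (f := fun x => 2 * ‖f x‖)
      (Filter.Eventually.of_forall fun x => by positivity) (hf.norm.const_mul 2).aemeasurable hc1
    have h2 : ∫⁻ x, ENNReal.ofReal ((2 * ‖f x‖) ^ (c - 1)) ∂ν =
        ENNReal.ofReal (2 ^ (c - 1)) * ∫⁻ x, (‖f x‖₊ : ℝ≥0∞) ^ c := by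
      rw [hν, lintegral_withDensity_eq_lintegral_mul _ hf.nnnorm.coe_nnreal_ennreal (by fun_prop),
        ← lintegral_const_mul' _ _ ENNReal.ofReal_ne_top]
      refine lintegral_congr fun x => ?_
      rw [Pi.mul_apply, Real.mul_rpow (by norm_num) (norm_nonneg _),
        ENNReal.ofReal_mul (by positivity), mul_left_comm,
        ← ENNReal.ofReal_rpow_of_nonneg (norm_nonneg _) hc1.le, ofReal_norm, enorm_eq_nnnorm]
      congr 1
      conv_rhs => rw [show c = 1 + (c - 1) by ring]
      rw [ENNReal.rpow_add_of_nonneg _ _ zero_le_one hc1.le, ENNReal.rpow_one]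
    rw [← h2, h1, ← mul_assoc, ENNReal.inv_mul_cancel (by simpa using hc) ENNReal.ofReal_ne_top,
      one_mul]
  have hN : ∀ N : ℕ, ∫⁻ x, (min (mx f x) N) ^ c ≤ ENNReal.ofReal c * (5 ^ n * 2 * J) := by
    intro N
    have hfin : ∀ x, min (mx f x) N ≠ ⊤ := fun x =>
      ((min_le_right _ _).trans_lt (ENNReal.natCast_lt_top N)).ne
    have h1 := lintegral_rpow_eq_lintegral_meas_lt_mul (volume : Measure (Fin n → ℝ))
      (f := fun x => (min (mx f x) N).toReal)
      (Filter.Eventually.of_forall fun x => ENNReal.toReal_nonneg)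
      ((measurable_mx f).min measurable_const).ennreal_toReal.aemeasurable hc0
    have h2 : ∀ x, ENNReal.ofReal ((min (mx f x) N).toReal ^ c) = (min (mx f x) N) ^ c := by
      intro x
      rw [← ENNReal.ofReal_rpow_of_nonneg ENNReal.toReal_nonneg hc0.le,
        ENNReal.ofReal_toReal (hfin x)]
    simp only [h2] at h1
    rw [h1, hJ, ← lintegral_const_mul' _ _
      (ENNReal.mul_ne_top (ENNReal.pow_ne_top (by norm_num)) (by norm_num))]
    refine mul_le_mul_right ?_ _
    refine setLIntegral_mono' measurableSet_Ioi fun t (ht : 0 < t) => ?_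
    have h3 : volume {x | t < (min (mx f x) N).toReal} ≤
        5 ^ n * 2 * (ENNReal.ofReal t)⁻¹ * ν {x | t < 2 * ‖f x‖} := by
      rw [hν, withDensity_apply _ (measurableSet_lt measurable_const (hf.norm.const_mul 2))]
      refine (measure_mono fun x (hx : t < _) => ?_).trans (volume_lt_mx_le_setLIntegral hn hf ht)
      exact ((ENNReal.ofReal_lt_iff_lt_toReal ht.le (hfin x)).2 hx).trans_le (min_le_left _ _)
    have h4 : ENNReal.ofReal (t ^ (c - 1 - 1)) =
        (ENNReal.ofReal t)⁻¹ * ENNReal.ofReal (t ^ (c - 1)) := by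
      rw [← ENNReal.ofReal_inv_of_pos ht, ← ENNReal.ofReal_mul (by positivity),
        Real.rpow_sub_one ht.ne', div_eq_inv_mul]
    calc _ ≤ 5 ^ n * 2 * (ENNReal.ofReal t)⁻¹ * ν {x | t < 2 * ‖f x‖} *
          ENNReal.ofReal (t ^ (c - 1)) := by gcongr
      _ = _ := by rw [h4]; ring
  have hmono : Monotone fun (N : ℕ) x => (min (mx f x) N) ^ c := by
    intro M N hMN x
    simp only
    gcongr
  calc ∫⁻ x, (mx f x) ^ c = ∫⁻ x, ⨆ N : ℕ, (min (mx f x) N) ^ c := by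
        simp only [iSup_min_natCast_rpow _ hc0]
    _ = ⨆ N : ℕ, ∫⁻ x, (min (mx f x) N) ^ c :=
        lintegral_iSup (fun N => ((measurable_mx f).min measurable_const).pow_const c) hmono
    _ ≤ ENNReal.ofReal c * (5 ^ n * 2 * J) := iSup_le hN
    _ = _ := by rw [hJeq]; ring

lemma exists_volume_inter_cube_ne_zero {E : Set (Fin n → ℝ)} (hE : volume E ≠ 0) :
    ∃ K : ℕ, ∀ k ≥ K, volume (E ∩ cube (fun _ => -(k + 1 : ℝ)) (2 * (k + 1))) ≠ 0 := by
  by_contra! h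
  refine hE (measure_mono_null ?_ (measure_iUnion_null fun K => (h K).choose_spec.2))
  intro x hx
  obtain ⟨K, hK⟩ := exists_nat_gt ‖x‖
  refine mem_iUnion.2 ⟨K, hx, fun i _ => ?_⟩
  have h1 := (norm_le_pi_norm x i).trans_lt hK
  rw [Real.norm_eq_abs, abs_lt] at h1
  have h2 : (K : ℝ) ≤ (h K).choose := by exact_mod_cast (h K).choose_spec.1
  constructor <;> linarith [h1.1, h1.2]

/-- A modular inequality forces the exponent not to take values on both sides of a gap. -/
lemma volume_eq_zero_or_of_modular {p : (Fin n → ℝ) → ℝ} (hp : Measurable p) (hp1 : ∀ x, 1 ≤ p x)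
    {C : ℝ} (hC : 0 < C)
    (h : ∀ f : (Fin n → ℝ) → ℝ, Measurable f →
      ∫⁻ x, (mx f x) ^ (p x) ≤ ENNReal.ofReal C * ∫⁻ x, (‖f x‖₊ : ℝ≥0∞) ^ (p x))
    {α β : ℝ} (hαβ : α < β) : volume {x | p x ≤ α} = 0 ∨ volume {x | β ≤ p x} = 0 := by
  by_contra! hne
  obtain ⟨hE, hF⟩ := hne
  obtain ⟨K₁, hK₁⟩ := exists_volume_inter_cube_ne_zero hE
  obtain ⟨K₂, hK₂⟩ := exists_volume_inter_cube_ne_zero hF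
  set k := max K₁ K₂
  have hs : (0 : ℝ) < 2 * ((k : ℝ) + 1) := by positivity
  set a : Fin n → ℝ := fun _ => -((k : ℝ) + 1)
  set Q := cube a (2 * ((k : ℝ) + 1))
  set E := {x | p x ≤ α} ∩ Q
  set F := {x | β ≤ p x} ∩ Q
  have hQm : MeasurableSet Q := (isOpen_cube _ _).measurableSet
  have hEm : MeasurableSet E := (measurableSet_le hp measurable_const).inter hQm
  have hFm : MeasurableSet F := (measurableSet_le measurable_const hp).inter hQm
  have hQ0 : volume Q ≠ 0 := volume_cube_ne_zero _ hs
  have hQtop : volume Q ≠ ⊤ := volume_cube_ne_top _ _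
  have hEtop : volume E ≠ ⊤ := measure_ne_top_of_subset inter_subset_right hQtop
  have hFtop : volume F ≠ ⊤ := measure_ne_top_of_subset inter_subset_right hQtop
  have hQpos : 0 < volume.real Q := ENNReal.toReal_pos hQ0 hQtop
  have hEpos : 0 < volume.real E := ENNReal.toReal_pos (hK₁ k (le_max_left _ _)) hEtop
  have hFpos : 0 < volume.real F := ENNReal.toReal_pos (hK₂ k (le_max_right _ _)) hFtop
  set δ := (volume.real Q)⁻¹ * volume.real E
  have hδ : 0 < δ := by positivity
  have key : ∀ t : ℝ, 1 ≤ t → 1 ≤ δ * t →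
      (δ * t) ^ β * volume.real F ≤ C * (t ^ α * volume.real E) := by
    intro t ht hδt
    have ht0 : 0 ≤ t := by linarith
    have hnorm : ∀ y, (‖E.indicator (fun _ => t) y‖₊ : ℝ≥0∞) =
        E.indicator (fun _ => ENNReal.ofReal t) y := by
      intro y
      by_cases hy : y ∈ E
      · simp only [hy, indicator_of_mem]
        rw [← enorm_eq_nnnorm, Real.enorm_eq_ofReal ht0]
      · simp [hy]
    have hmx : ∀ x ∈ Q, ENNReal.ofReal (δ * t) ≤ mx (E.indicator fun _ => t) x := by
      intro x hx
      refine le_trans (le_of_eq ?_) (average_le_mx _ hs hx)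
      simp only [hnorm]
      rw [lintegral_indicator_const hEm, Measure.restrict_apply hEm,
        inter_eq_self_of_subset_left inter_subset_right, ENNReal.ofReal_mul hδ.le,
        ENNReal.ofReal_mul (by positivity), ENNReal.ofReal_inv_of_pos hQpos,
        ofReal_measureReal hQtop, ofReal_measureReal hEtop, mul_assoc,
        mul_comm (ENNReal.ofReal t)]
    have h1 : ENNReal.ofReal ((δ * t) ^ β) * volume F ≤
        ENNReal.ofReal C * (ENNReal.ofReal (t ^ α) * volume E) := by
      calc ENNReal.ofReal ((δ * t) ^ β) * volume F
          = ∫⁻ _ in F, ENNReal.ofReal ((δ * t) ^ β) := (setLIntegral_const _ _).symm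
        _ ≤ ∫⁻ x in F, (mx (E.indicator fun _ => t) x) ^ (p x) := by
            refine setLIntegral_mono' hFm fun x hx => ?_
            have hpx : 0 ≤ p x := by linarith [hp1 x]
            calc ENNReal.ofReal ((δ * t) ^ β) ≤ ENNReal.ofReal ((δ * t) ^ p x) :=
                  ENNReal.ofReal_le_ofReal (Real.rpow_le_rpow_of_exponent_le hδt hx.1)
              _ = ENNReal.ofReal (δ * t) ^ p x :=
                  (ENNReal.ofReal_rpow_of_nonneg (by positivity) hpx).symm
              _ ≤ _ := by gcongr; exact hmx x hx.2
        _ ≤ ∫⁻ x, (mx (E.indicator fun _ => t) x) ^ (p x) := setLIntegral_le_lintegral _ _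
        _ ≤ ENNReal.ofReal C * ∫⁻ x, (‖E.indicator (fun _ => t) x‖₊ : ℝ≥0∞) ^ (p x) :=
            h _ (measurable_const.indicator hEm)
        _ ≤ ENNReal.ofReal C * ∫⁻ x, E.indicator (fun _ => ENNReal.ofReal (t ^ α)) x := by
            gcongr with x
            rw [hnorm]
            have hpx : 0 < p x := by linarith [hp1 x]
            by_cases hx : x ∈ E
            · simp only [hx, indicator_of_mem]
              rw [ENNReal.ofReal_rpow_of_nonneg ht0 hpx.le]
              exact ENNReal.ofReal_le_ofReal (Real.rpow_le_rpow_of_exponent_le ht hx.1)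
            · simp [hx, hpx]
        _ = _ := by rw [lintegral_indicator_const hEm]
    rw [← ofReal_measureReal hFtop, ← ofReal_measureReal hEtop,
      ← ENNReal.ofReal_mul (by positivity), ← ENNReal.ofReal_mul (by positivity),
      ← ENNReal.ofReal_mul hC.le] at h1
    exact (ENNReal.ofReal_le_ofReal_iff (by positivity)).1 h1
  have hlim := tendsto_rpow_atTop (sub_pos.2 hαβ)
  obtain ⟨t, ht, ht1, htδ⟩ := ((hlim.eventually_gt_atTop
    (C * volume.real E / (δ ^ β * volume.real F))).and
      ((Filter.eventually_ge_atTop 1).and (Filter.eventually_ge_atTop δ⁻¹))).exists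
  have ht0 : 0 < t := by linarith
  have h1 := key t ht1 (by rwa [inv_le_iff_one_le_mul₀' hδ] at htδ)
  rw [div_lt_iff₀ (by positivity), Real.rpow_sub ht0, div_mul_eq_mul_div,
    lt_div_iff₀ (by positivity)] at ht
  rw [Real.mul_rpow hδ.le ht0.le] at h1
  linarith

/-- The maximal function of the indicator of the unit cube has mass at least `1 / 2` in each
dyadic shell around that cube. -/
lemma natCast_le_lintegral_mx_indicator (hn : 0 < n) (N : ℕ) :
    (N : ℝ≥0∞) ≤ 2 * ∫⁻ x in cube (0 : Fin n → ℝ) (2 ^ N),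
      mx ((cube (0 : Fin n → ℝ) 1).indicator fun _ => 1) x := by
  induction N with
  | zero => simp
  | succ N ih =>
    set g := mx ((cube (0 : Fin n → ℝ) 1).indicator fun _ => 1)
    set A := cube (0 : Fin n → ℝ) (2 ^ N)
    set B := cube (0 : Fin n → ℝ) (2 ^ (N + 1))
    have hpow : ∀ {r s : ℝ}, r ≤ s → cube (0 : Fin n → ℝ) r ⊆ cube 0 s := fun hrs x hx i hi =>
      ⟨(hx i hi).1, (hx i hi).2.trans_le (by gcongr)⟩
    have hAB : A ⊆ B := hpow (by gcongr <;> norm_num)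
    have hAm : MeasurableSet A := (isOpen_cube _ _).measurableSet
    have hBm : MeasurableSet B := (isOpen_cube _ _).measurableSet
    have hB0 : volume B ≠ 0 := volume_cube_ne_zero _ (by positivity)
    have hBtop : volume B ≠ ⊤ := volume_cube_ne_top _ _
    have hsplit : volume B = volume A + volume (B \ A) := by
      rw [← measure_union disjoint_sdiff_right (hBm.diff hAm), union_sdiff_cancel hAB]
    have hdouble : volume A + volume A ≤ volume B := by
      simp only [A, B, volume_cube]
      rw [← two_mul, pow_succ', ENNReal.ofReal_mul (by norm_num), mul_pow]
      gcongr
      rw [ENNReal.ofReal_ofNat]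
      exact le_self_pow₀ (by norm_num) hn.ne'
    have hdiff : volume B ≤ 2 * volume (B \ A) := by
      have h1 : volume A ≤ volume (B \ A) := by
        rw [hsplit] at hdouble
        exact (ENNReal.add_le_add_iff_left (volume_cube_ne_top _ _)).1 hdouble
      rw [hsplit, two_mul]
      gcongr
    have hlow : ∀ x ∈ B \ A, (volume B)⁻¹ ≤ g x := by
      intro x hx
      refine le_trans (le_of_eq ?_) (average_le_mx _ (by positivity) hx.1)
      have h1 : ∀ y : Fin n → ℝ,
          (‖(cube (0 : Fin n → ℝ) 1).indicator (fun _ => (1 : ℝ)) y‖₊ : ℝ≥0∞) =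
          (cube (0 : Fin n → ℝ) 1).indicator (fun _ => 1) y := by
        intro y
        by_cases hy : y ∈ cube (0 : Fin n → ℝ) 1 <;> simp [hy]
      simp only [h1]
      rw [lintegral_indicator_const (isOpen_cube _ _).measurableSet,
        Measure.restrict_apply (isOpen_cube _ _).measurableSet,
        inter_eq_self_of_subset_left (hpow (one_le_pow₀ (by norm_num))), volume_cube 0 1]
      simp [B]
    have hone : 1 ≤ 2 * ∫⁻ x in B \ A, g x := by
      calc (1 : ℝ≥0∞) = (volume B)⁻¹ * volume B := (ENNReal.inv_mul_cancel hB0 hBtop).symm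
        _ ≤ (volume B)⁻¹ * (2 * volume (B \ A)) := by gcongr
        _ = 2 * ∫⁻ _ in B \ A, (volume B)⁻¹ := by rw [setLIntegral_const]; ring
        _ ≤ _ := by gcongr 2 * ?_; exact setLIntegral_mono' (hBm.diff hAm) hlow
    rw [← union_sdiff_cancel hAB, lintegral_union (hBm.diff hAm) disjoint_sdiff_right, mul_add]
    push_cast
    gcongr

/-- The maximal function of the indicator of the unit cube is not integrable. -/
lemma lintegral_mx_indicator_eq_top (hn : 0 < n) :
    ∫⁻ x, mx ((cube (0 : Fin n → ℝ) 1).indicator fun _ => 1) x = ⊤ := by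
  by_contra h
  obtain ⟨N, hN⟩ := ENNReal.exists_nat_gt (ENNReal.mul_ne_top ENNReal.ofNat_ne_top h (a := 2))
  refine hN.not_ge ((natCast_le_lintegral_mx_indicator hn N).trans ?_)
  gcongr
  exact Measure.restrict_le_self

end Maximal

/-- Lerner's theorem: for `p(·) ∈ 𝒫(ℝⁿ)` with `p₊ < ∞`, the modular
inequality `∫_{ℝⁿ} (Mf)^{p(x)} ≤ C ∫_{ℝⁿ} |f|^{p(x)}` holds for some `C > 0` iff
`p(·)` equals a constant `c > 1` almost everywhere. -/
theorem statement6 {n : ℕ} (hn : 0 < n) (p : (Fin n → ℝ) → ℝ)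
    (hp : IsExponent Set.univ p) (hpfin : pSup Set.univ p < ⊤) :
    (∃ C : ℝ, 0 < C ∧ ∀ f : (Fin n → ℝ) → ℝ, Measurable f →
        ∫⁻ x, (mx f x) ^ (p x) ≤ ENNReal.ofReal C * ∫⁻ x, (‖f x‖₊ : ℝ≥0∞) ^ (p x)) ↔
      ∃ c : ℝ, 1 < c ∧ ∀ᵐ x : Fin n → ℝ, p x = c := by
  constructor
  · rintro ⟨C, hC, h⟩
    have hgap := fun α β : ℝ => volume_eq_zero_or_of_modular hp.1 (fun x => hp.2 x (mem_univ x))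
      hC h (α := α) (β := β)
    obtain ⟨c, hc⟩ : ∃ c, p =ᵐ[volume] Function.const _ c := by
      refine Filter.exists_eventuallyEq_const_of_forall_separating (· ∈ range (Iic : ℝ → Set ℝ)) ?_
      rintro _ ⟨q, rfl⟩
      by_cases hq : volume {x | p x ≤ q} = 0
      · right
        rw [ae_iff]
        simpa using hq
      · left
        rw [ae_iff]
        refine measure_mono_null ?_ (measure_iUnion_null fun m : ℕ =>
          (hgap q (q + 1 / (m + 1)) (by simp; positivity)).resolve_left hq)
        intro x hx
        have hx' : q < p x := by simpa using hx
        obtain ⟨m, hm⟩ := exists_nat_one_div_lt (sub_pos.2 hx')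
        exact mem_iUnion.2 ⟨m, by simp only [mem_ofPred_eq]; linarith⟩
    refine ⟨c, ?_, hc⟩
    have hc1 : 1 ≤ c := by
      obtain ⟨x, hx⟩ := hc.exists
      exact (hp.2 x (mem_univ x)).trans_eq hx
    refine hc1.lt_of_ne fun hc1 => ?_
    subst hc1
    have h1 := h ((cube (0 : Fin n → ℝ) 1).indicator fun _ => 1)
      (measurable_const.indicator (isOpen_cube _ _).measurableSet)
    have h2 : ∀ g : (Fin n → ℝ) → ℝ≥0∞, ∫⁻ x, g x ^ p x = ∫⁻ x, g x := fun g =>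
      lintegral_congr_ae (hc.mono fun x hx => by simp [hx])
    rw [h2, h2, lintegral_mx_indicator_eq_top hn, top_le_iff] at h1
    refine ENNReal.mul_ne_top ENNReal.ofReal_ne_top ?_ h1
    simp only [nnnorm_indicator_eq_indicator_nnnorm, ENNReal.coe_indicator, nnnorm_one,
      ENNReal.coe_one]
    rw [lintegral_indicator_const (isOpen_cube _ _).measurableSet, one_mul]
    exact volume_cube_ne_top _ _
  · rintro ⟨c, hc, hpc⟩
    set K := ENNReal.ofReal c * (5 ^ n * 2 * ((ENNReal.ofReal (c - 1))⁻¹ *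
      ENNReal.ofReal (2 ^ (c - 1)))) with hK
    have hKtop : K ≠ ⊤ := by
      refine ENNReal.mul_ne_top ENNReal.ofReal_ne_top (ENNReal.mul_ne_top (ENNReal.mul_ne_top
        (ENNReal.pow_ne_top (by norm_num)) (by norm_num)) (ENNReal.mul_ne_top
          (ENNReal.inv_ne_top.2 ?_) ENNReal.ofReal_ne_top))
      simpa using hc
    refine ⟨K.toReal + 1, by positivity, fun f hf => ?_⟩
    have h2 : ∀ g : (Fin n → ℝ) → ℝ≥0∞, ∫⁻ x, g x ^ p x = ∫⁻ x, g x ^ c := fun g =>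
      lintegral_congr_ae (hpc.mono fun x hx => by simp only [hx])
    rw [h2, h2]
    refine (lintegral_mx_rpow_le hn hc hf).trans ?_
    gcongr
    rw [← hK, ENNReal.le_ofReal_iff_toReal_le hKtop (by positivity)]
    linarith
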